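/- arXiv:1506.04514 — 2 statements merged into one kernel-verified Lean document; each statement's English description precedes it below -/
import Mathlib

section
/- (Theorem 1 of the paper.) Assume Assumption 1 holds. Let π_S be a policy maximizing the simulated return, i.e., ρ(π_S, P̂, r) ≥ ρ(π, P̂, r) for every policy π, and let π⋆ be a policy maximizing the true return, i.e., ρ(π⋆, P⋆, r) ≥ ρ(π, P⋆, r) for every policy π. Then the performance loss of π_S satisfies ρ(π⋆, P⋆, r) − ρ(π_S, P⋆, r) ≤ (2·γ·Rmax/(1−γ)²) · max_{x,a} e x a. -/
open Matrix

/-- The row-stochastic matrix induced by a policy `π` from a transition kernel `P`. -/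
noncomputable def polMat {X A : Type*} [Fintype A]
    (P : X → A → X → ℝ) (π : X → A → ℝ) : Matrix X X ℝ :=
  Matrix.of fun x x' => ∑ a, π x a * P x a x'

/-- The reward vector induced by a policy `π` from a reward function `r`. -/
noncomputable def polRew {X A : Type*} [Fintype A]
    (r : X → A → ℝ) (π : X → A → ℝ) : X → ℝ :=
  fun x => ∑ a, π x a * r x a

/-- The value function `V^π_{P,r} = (1 - γ • P_π)⁻¹ *ᵥ r_π`. -/
noncomputable def valueFn {X A : Type*} [Fintype X] [DecidableEq X] [Fintype A]
    (γ : ℝ) (P : X → A → X → ℝ) (r : X → A → ℝ) (π : X → A → ℝ) : X → ℝ :=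
  ((1 : Matrix X X ℝ) - γ • polMat P π)⁻¹ *ᵥ polRew r π

/-- The return `ρ(π, P, r) = ∑ x, p0 x * V^π_{P,r} x`. -/
noncomputable def ret {X A : Type*} [Fintype X] [DecidableEq X] [Fintype A]
    (p0 : X → ℝ) (γ : ℝ) (P : X → A → X → ℝ) (r : X → A → ℝ) (π : X → A → ℝ) : ℝ :=
  ∑ x, p0 x * valueFn γ P r π x

/-- A transition kernel: nonnegative entries, each row summing to one. -/
def IsKernel {X A : Type*} [Fintype X] (P : X → A → X → ℝ) : Prop :=
  (∀ x a x', 0 ≤ P x a x') ∧ ∀ x a, ∑ x', P x a x' = 1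

/-- A randomized stationary policy. -/
def IsPolicy {X A : Type*} [Fintype A] (π : X → A → ℝ) : Prop :=
  (∀ x a, 0 ≤ π x a) ∧ ∀ x, ∑ a, π x a = 1

/-- The error function `e_π x = ∑ a, π x a * e x a` induced by a policy. -/
noncomputable def polErr {X A : Type*} [Fintype A]
    (e : X → A → ℝ) (π : X → A → ℝ) : X → ℝ :=
  fun x => ∑ a, π x a * e x a

/-- The normalized state occupancy frequency
`u^π_P x = (1 - γ) * ∑ y, p0 y * ((1 - γ • P_π)⁻¹) y x`. -/
noncomputable def occupancy {X A : Type*} [Fintype X] [DecidableEq X] [Fintype A]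
    (p0 : X → ℝ) (γ : ℝ) (P : X → A → X → ℝ) (π : X → A → ℝ) : X → ℝ :=
  fun x => (1 - γ) * ∑ y, p0 y * ((1 : Matrix X X ℝ) - γ • polMat P π)⁻¹ y x

/-- Contraction bound for a row-stochastic fixed-point equation. -/
lemma fixed_bound {X : Type*} [Fintype X] [Nonempty X] (γ : ℝ) (hγ0 : 0 ≤ γ) (hγ1 : γ < 1)
    (M : Matrix X X ℝ) (hM0 : ∀ x y, 0 ≤ M x y) (hM1 : ∀ x, ∑ y, M x y = 1)
    (c v : X → ℝ) (B : ℝ) (hc : ∀ x, |c x| ≤ B)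
    (hv : ∀ x, v x = c x + γ * ∑ y, M x y * v y) (x : X) : |v x| ≤ B / (1 - γ) := by
  obtain ⟨z, hz⟩ := Finite.exists_max (fun x => |v x|)
  refine (hz x).trans ?_
  rw [le_div_iff₀ (by linarith)]
  have h1 : |∑ y, M z y * v y| ≤ |v z| := by
    calc |∑ y, M z y * v y| ≤ ∑ y, |M z y * v y| := Finset.abs_sum_le_sum_abs _ _
      _ ≤ ∑ y, M z y * |v z| := by
        refine Finset.sum_le_sum fun y _ => ?_
        rw [abs_mul, abs_of_nonneg (hM0 z y)]
        exact mul_le_mul_of_nonneg_left (hz y) (hM0 z y)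
      _ = |v z| := by rw [← Finset.sum_mul, hM1, one_mul]
  have h2 : |v z| ≤ B + γ * |v z| := by
    calc |v z| = |c z + γ * ∑ y, M z y * v y| := by rw [← hv z]
      _ ≤ |c z| + |γ * ∑ y, M z y * v y| := abs_add_le _ _
      _ ≤ B + γ * |v z| := by
        rw [abs_mul, abs_of_nonneg hγ0]
        exact add_le_add (hc z) (mul_le_mul_of_nonneg_left h1 hγ0)
  linarith

lemma polMat_nonneg {X A : Type*} [Fintype X] [Fintype A] {P : X → A → X → ℝ} {π : X → A → ℝ}
    (hP : IsKernel P) (hπ : IsPolicy π) (x y : X) : 0 ≤ polMat P π x y :=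
  Finset.sum_nonneg fun a _ => mul_nonneg (hπ.1 x a) (hP.1 x a y)

lemma polMat_sum {X A : Type*} [Fintype X] [Fintype A] {P : X → A → X → ℝ} {π : X → A → ℝ}
    (hP : IsKernel P) (hπ : IsPolicy π) (x : X) : ∑ y, polMat P π x y = 1 := by
  simp only [polMat, Matrix.of_apply]
  rw [Finset.sum_comm]
  simp only [← Finset.mul_sum, hP.2, mul_one, hπ.2]

/-- A policy average of bounded quantities is bounded. -/
lemma avg_bound {X A : Type*} [Fintype A] {π : X → A → ℝ} (hπ : IsPolicy π) (x : X)
    (f : A → ℝ) (B : ℝ) (hf : ∀ a, |f a| ≤ B) : |∑ a, π x a * f a| ≤ B := by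
  calc |∑ a, π x a * f a| ≤ ∑ a, |π x a * f a| := Finset.abs_sum_le_sum_abs _ _
    _ ≤ ∑ a, π x a * B := by
      refine Finset.sum_le_sum fun a _ => ?_
      rw [abs_mul, abs_of_nonneg (hπ.1 x a)]
      exact mul_le_mul_of_nonneg_left (hf a) (hπ.1 x a)
    _ = B := by rw [← Finset.sum_mul, hπ.2, one_mul]

lemma valueFn_eq {X A : Type*} [Fintype X] [Nonempty X] [DecidableEq X] [Fintype A]
    (γ : ℝ) (hγ0 : 0 ≤ γ) (hγ1 : γ < 1) (r : X → A → ℝ) {P : X → A → X → ℝ} {π : X → A → ℝ}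
    (hP : IsKernel P) (hπ : IsPolicy π) (x : X) :
    valueFn γ P r π x = polRew r π x + γ * ∑ y, polMat P π x y * valueFn γ P r π y := by
  have hu : IsUnit ((1 : Matrix X X ℝ) - γ • polMat P π) := by
    rw [← Matrix.mulVec_injective_iff_isUnit]
    intro v w hvw
    funext x
    have hvw' : ((1 : Matrix X X ℝ) - γ • polMat P π) *ᵥ (v - w) = 0 := by
      rw [Matrix.mulVec_sub, sub_eq_zero]; exact hvw
    rw [Matrix.sub_mulVec, Matrix.one_mulVec, Matrix.smul_mulVec] at hvw'
    have := fixed_bound γ hγ0 hγ1 (polMat P π) (polMat_nonneg hP hπ) (polMat_sum hP hπ)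
      0 (v - w) 0 (by simp) (fun x => by
        have := congrFun hvw' x
        simp only [Pi.sub_apply, Pi.smul_apply, Matrix.mulVec, dotProduct, smul_eq_mul,
          Pi.zero_apply] at this ⊢
        linarith) x
    rw [zero_div] at this
    have h0 := abs_nonpos_iff.mp this
    rw [Pi.sub_apply] at h0
    linarith
  have h : ((1 : Matrix X X ℝ) - γ • polMat P π) *ᵥ valueFn γ P r π = polRew r π := by
    rw [valueFn, Matrix.mulVec_mulVec, Matrix.mul_nonsing_inv _ ((Matrix.isUnit_iff_isUnit_det _).mp hu),
      Matrix.one_mulVec]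
  rw [Matrix.sub_mulVec, Matrix.one_mulVec, Matrix.smul_mulVec] at h
  have := congrFun h x
  simp only [Pi.sub_apply, Pi.smul_apply, Matrix.mulVec, dotProduct, smul_eq_mul] at this
  linarith

/-- Simulation lemma. -/
lemma ret_diff {X A : Type*} [Fintype X] [Nonempty X] [DecidableEq X] [Fintype A]
    (γ : ℝ) (hγ0 : 0 ≤ γ) (hγ1 : γ < 1) (Rmax : ℝ) (hR : 0 ≤ Rmax)
    (r : X → A → ℝ) (hr : ∀ x a, |r x a| ≤ Rmax)
    (p0 : X → ℝ) (hp0 : ∀ x, 0 ≤ p0 x) (hp1 : ∑ x, p0 x = 1)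
    (P Q : X → A → X → ℝ) (hP : IsKernel P) (hQ : IsKernel Q) (E : ℝ)
    (hE : ∀ x a, ∑ x', |P x a x' - Q x a x'| ≤ E)
    (π : X → A → ℝ) (hπ : IsPolicy π) :
    |ret p0 γ P r π - ret p0 γ Q r π| ≤ γ * Rmax / (1 - γ) ^ 2 * E := by
  have h1γ : 0 < 1 - γ := by linarith
  have hV : ∀ y, |valueFn γ Q r π y| ≤ Rmax / (1 - γ) :=
    fixed_bound γ hγ0 hγ1 (polMat Q π) (polMat_nonneg hQ hπ) (polMat_sum hQ hπ) (polRew r π) _ _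
      (fun x => avg_bound hπ x _ _ (hr x)) (valueFn_eq γ hγ0 hγ1 r hQ hπ)
  have hc : ∀ x, |γ * ∑ a, π x a * ∑ y, (P x a y - Q x a y) * valueFn γ Q r π y|
      ≤ γ * (E * (Rmax / (1 - γ))) := by
    intro x
    rw [abs_mul, abs_of_nonneg hγ0]
    refine mul_le_mul_of_nonneg_left (avg_bound hπ x _ _ fun a => ?_) hγ0
    calc |∑ y, (P x a y - Q x a y) * valueFn γ Q r π y|
        ≤ ∑ y, |(P x a y - Q x a y) * valueFn γ Q r π y| := Finset.abs_sum_le_sum_abs _ _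
      _ ≤ ∑ y, |P x a y - Q x a y| * (Rmax / (1 - γ)) := by
        refine Finset.sum_le_sum fun y _ => ?_
        rw [abs_mul]
        exact mul_le_mul_of_nonneg_left (hV y) (abs_nonneg _)
      _ ≤ E * (Rmax / (1 - γ)) := by
        rw [← Finset.sum_mul]
        exact mul_le_mul_of_nonneg_right (hE x a) (by positivity)
  have hsw : ∀ x, ∑ a, π x a * ∑ y, (P x a y - Q x a y) * valueFn γ Q r π y
      = ∑ y, polMat P π x y * valueFn γ Q r π y - ∑ y, polMat Q π x y * valueFn γ Q r π y := by
    intro x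
    simp only [polMat, Matrix.of_apply, Finset.mul_sum, Finset.sum_mul]
    rw [Finset.sum_comm, ← Finset.sum_sub_distrib]
    refine Finset.sum_congr rfl fun y _ => ?_
    rw [← Finset.sum_sub_distrib]
    exact Finset.sum_congr rfl fun a _ => by ring
  have hD := fixed_bound γ hγ0 hγ1 (polMat P π) (polMat_nonneg hP hπ) (polMat_sum hP hπ) _
    (fun x => valueFn γ P r π x - valueFn γ Q r π x) _ hc (fun x => by
      simp only [mul_sub, Finset.sum_sub_distrib]
      rw [hsw x]
      linarith [valueFn_eq γ hγ0 hγ1 r hP hπ x, valueFn_eq γ hγ0 hγ1 r hQ hπ x])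
  have hav := avg_bound (X := Unit) (π := fun _ => p0) ⟨fun _ => hp0, fun _ => hp1⟩ () _ _ hD
  have he : ret p0 γ P r π - ret p0 γ Q r π
      = ∑ x, p0 x * (valueFn γ P r π x - valueFn γ Q r π x) := by
    simp only [ret, mul_sub, Finset.sum_sub_distrib]
  rw [he]
  refine hav.trans (le_of_eq ?_)
  field_simp

/-- Theorem 1: the performance loss of the simulator-optimal policy
is at most `(2 γ Rmax/(1−γ)²) · max_{x,a} e x a`. -/
theorem perf_loss_naive
    {X A : Type*} [Fintype X] [Nonempty X] [DecidableEq X] [Fintype A] [Nonempty A]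
    (γ : ℝ) (hγ0 : 0 ≤ γ) (hγ1 : γ < 1)
    (Rmax : ℝ) (hR : 0 ≤ Rmax)
    (r : X → A → ℝ) (hr : ∀ x a, |r x a| ≤ Rmax)
    (p0 : X → ℝ) (hp0 : ∀ x, 0 ≤ p0 x) (hp1 : ∑ x, p0 x = 1)
    (Pstar Phat : X → A → X → ℝ) (hPstar : IsKernel Pstar) (hPhat : IsKernel Phat)
    (e : X → A → ℝ)
    (hAsm : ∀ x a, ∑ x', |Pstar x a x' - Phat x a x'| ≤ e x a)
    (πS : X → A → ℝ) (hπS : IsPolicy πS)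
    (hπSopt : ∀ π : X → A → ℝ, IsPolicy π → ret p0 γ Phat r π ≤ ret p0 γ Phat r πS)
    (πstar : X → A → ℝ) (hπstar : IsPolicy πstar)
    (hπstaropt : ∀ π : X → A → ℝ, IsPolicy π → ret p0 γ Pstar r π ≤ ret p0 γ Pstar r πstar) :
    ret p0 γ Pstar r πstar - ret p0 γ Pstar r πS ≤
      2 * γ * Rmax / (1 - γ) ^ 2 *
        (Finset.univ : Finset (X × A)).sup' Finset.univ_nonempty (fun q => e q.1 q.2) := by
  set E := (Finset.univ : Finset (X × A)).sup' Finset.univ_nonempty (fun q => e q.1 q.2) with hEdef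
  have hE : ∀ x a, ∑ x', |Pstar x a x' - Phat x a x'| ≤ E := fun x a =>
    (hAsm x a).trans (Finset.le_sup' (fun q : X × A => e q.1 q.2) (Finset.mem_univ (x, a)))
  have h1 := ret_diff γ hγ0 hγ1 Rmax hR r hr p0 hp0 hp1 Pstar Phat hPstar hPhat E hE πstar hπstar
  have h2 := ret_diff γ hγ0 hγ1 Rmax hR r hr p0 hp0 hp1 Pstar Phat hPstar hPhat E hE πS hπS
  have h3 := hπSopt πstar hπstar
  have h4 : 2 * γ * Rmax / (1 - γ) ^ 2 * E = 2 * (γ * Rmax / (1 - γ) ^ 2 * E) := by ring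
  rw [h4]
  linarith [(abs_le.mp h1).2, (abs_le.mp h2).1]
end

section
/- (Return deviation over the uncertainty set.) Assume Assumption 1 holds and let U(P̂, e) be the set of all transition kernels P with ∑_{x'} |P x a x' − P̂ x a x'| ≤ e x a for all x, a. Then for every kernel P ∈ U(P̂, e) and every policy π, |ρ(π, P, r) − ρ(π, P⋆, r)| ≤ (2·γ·Rmax/(1−γ)²) · ∑_x u^π_{P⋆} x · e_π x, where e_π x = ∑_a π x a · e x a and u^π_{P⋆} x = (1−γ) · ∑_y p0 y · ((1 − γ·P⋆_π)⁻¹) y x is the normalized state occupancy of π under P⋆. -/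
open Matrix

/-- Minimum principle for `1 - γ S`. -/
theorem min_principle {X : Type*} [Fintype X] [Nonempty X] [DecidableEq X]
    (γ : ℝ) (hγ0 : 0 ≤ γ) (hγ1 : γ < 1) (S : Matrix X X ℝ)
    (hS0 : ∀ x y, 0 ≤ S x y) (hS1 : ∀ x, ∑ y, S x y = 1) (v : X → ℝ)
    (hv : ∀ x, 0 ≤ (((1 : Matrix X X ℝ) - γ • S) *ᵥ v) x) : ∀ x, 0 ≤ v x := by
  obtain ⟨m, hm⟩ := Finite.exists_min v
  have h := hv m
  rw [Matrix.sub_mulVec, Matrix.one_mulVec, Matrix.smul_mulVec] at h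
  simp only [Pi.sub_apply, Pi.smul_apply, smul_eq_mul, Matrix.mulVec, dotProduct] at h
  have h2 : v m ≤ ∑ y, S m y * v y := by
    calc v m = ∑ y, S m y * v m := by rw [← Finset.sum_mul, hS1, one_mul]
      _ ≤ _ := Finset.sum_le_sum fun y _ => mul_le_mul_of_nonneg_left (hm y) (hS0 m y)
  have h3 : γ * v m ≤ γ * ∑ y, S m y * v y := mul_le_mul_of_nonneg_left h2 hγ0
  have h4 : 0 ≤ v m := by
    by_contra hc
    push Not at hc
    nlinarith
  exact fun x => h4.trans (hm x)

theorem isUnit_det_aux {X : Type*} [Fintype X] [Nonempty X] [DecidableEq X]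
    (γ : ℝ) (hγ0 : 0 ≤ γ) (hγ1 : γ < 1) (S : Matrix X X ℝ)
    (hS0 : ∀ x y, 0 ≤ S x y) (hS1 : ∀ x, ∑ y, S x y = 1) :
    IsUnit ((1 : Matrix X X ℝ) - γ • S).det := by
  rw [isUnit_iff_ne_zero]
  intro h0
  obtain ⟨v, hv, hz⟩ := Matrix.exists_mulVec_eq_zero_iff.mpr h0
  apply hv
  have h1 := min_principle γ hγ0 hγ1 S hS0 hS1 v (by intro x; simp [hz])
  have h2 := min_principle γ hγ0 hγ1 S hS0 hS1 (-v) (by intro x; simp [Matrix.mulVec_neg, hz])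
  funext x
  have a := h1 x
  have b := h2 x
  simp only [Pi.neg_apply] at b
  simp only [Pi.zero_apply]
  linarith

theorem inv_nonneg_aux {X : Type*} [Fintype X] [Nonempty X] [DecidableEq X]
    (γ : ℝ) (hγ0 : 0 ≤ γ) (hγ1 : γ < 1) (S : Matrix X X ℝ)
    (hS0 : ∀ x y, 0 ≤ S x y) (hS1 : ∀ x, ∑ y, S x y = 1) (y x : X) :
    0 ≤ ((1 : Matrix X X ℝ) - γ • S)⁻¹ y x := by
  have hu := isUnit_det_aux γ hγ0 hγ1 S hS0 hS1
  have h := min_principle γ hγ0 hγ1 S hS0 hS1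
    (((1 : Matrix X X ℝ) - γ • S)⁻¹ *ᵥ Pi.single x 1) (by
      intro z
      rw [Matrix.mulVec_mulVec, Matrix.mul_nonsing_inv _ hu, Matrix.one_mulVec]
      by_cases hz : z = x
      · subst hz; simp
      · simp [Pi.single_eq_of_ne hz]) y
  simpa using h

theorem value_bound_aux {X : Type*} [Fintype X] [Nonempty X] [DecidableEq X]
    (γ : ℝ) (hγ0 : 0 ≤ γ) (hγ1 : γ < 1) (S : Matrix X X ℝ)
    (hS0 : ∀ x y, 0 ≤ S x y) (hS1 : ∀ x, ∑ y, S x y = 1) (R : ℝ) (v : X → ℝ)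
    (hv : ∀ x, |(((1 : Matrix X X ℝ) - γ • S) *ᵥ v) x| ≤ R) (x : X) :
    |v x| ≤ R / (1 - γ) := by
  have hg : (1 - γ) ≠ 0 := by linarith
  have hc : ∀ z, (((1 : Matrix X X ℝ) - γ • S) *ᵥ (fun _ => R / (1 - γ))) z = R := by
    intro z
    rw [Matrix.sub_mulVec, Matrix.one_mulVec, Matrix.smul_mulVec]
    simp only [Pi.sub_apply, Pi.smul_apply, smul_eq_mul, Matrix.mulVec, dotProduct]
    rw [← Finset.sum_mul, hS1]
    field_simp
  have h1 := min_principle γ hγ0 hγ1 S hS0 hS1 ((fun _ => R / (1 - γ)) - v) (by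
    intro z
    rw [Matrix.mulVec_sub, Pi.sub_apply, hc]
    linarith [(abs_le.mp (hv z)).2]) x
  have h2 := min_principle γ hγ0 hγ1 S hS0 hS1 ((fun _ => R / (1 - γ)) + v) (by
    intro z
    rw [Matrix.mulVec_add, Pi.add_apply, hc]
    linarith [(abs_le.mp (hv z)).1]) x
  simp only [Pi.sub_apply, Pi.add_apply] at h1 h2
  rw [abs_le]
  constructor <;> linarith

theorem polMat_nonneg_aux {X A : Type*} [Fintype X] [Fintype A]
    (P : X → A → X → ℝ) (π : X → A → ℝ) (hP : IsKernel P) (hπ : IsPolicy π) (x y : X) :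
    0 ≤ polMat P π x y :=
  Finset.sum_nonneg fun a _ => mul_nonneg (hπ.1 x a) (hP.1 x a y)

theorem polMat_sum_aux {X A : Type*} [Fintype X] [Fintype A]
    (P : X → A → X → ℝ) (π : X → A → ℝ) (hP : IsKernel P) (hπ : IsPolicy π) (x : X) :
    ∑ y, polMat P π x y = 1 := by
  simp only [polMat, Matrix.of_apply]
  rw [Finset.sum_comm]
  simp only [← Finset.mul_sum, hP.2, mul_one, hπ.2]

/-- return deviation over the uncertainty set: for every kernel
`P ∈ U(P̂, e)` and policy `π`,
`|ρ(π, P, r) − ρ(π, P⋆, r)| ≤ (2 γ Rmax/(1−γ)²) ∑_x u^π_{P⋆} x · e_π x`. -/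
theorem return_deviation_over_uncertainty_set
    {X A : Type*} [Fintype X] [Nonempty X] [DecidableEq X] [Fintype A] [Nonempty A]
    (γ : ℝ) (hγ0 : 0 ≤ γ) (hγ1 : γ < 1)
    (Rmax : ℝ) (hR : 0 ≤ Rmax)
    (r : X → A → ℝ) (hr : ∀ x a, |r x a| ≤ Rmax)
    (p0 : X → ℝ) (hp0 : ∀ x, 0 ≤ p0 x) (hp1 : ∑ x, p0 x = 1)
    (Pstar Phat : X → A → X → ℝ) (hPstar : IsKernel Pstar) (hPhat : IsKernel Phat)
    (e : X → A → ℝ)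
    (hAsm : ∀ x a, ∑ x', |Pstar x a x' - Phat x a x'| ≤ e x a)
    (P : X → A → X → ℝ) (hP : IsKernel P)
    (hPU : ∀ x a, ∑ x', |P x a x' - Phat x a x'| ≤ e x a)
    (π : X → A → ℝ) (hπ : IsPolicy π) :
    |ret p0 γ P r π - ret p0 γ Pstar r π| ≤
      2 * γ * Rmax / (1 - γ) ^ 2 * ∑ x, occupancy p0 γ Pstar π x * polErr e π x := by
  have hg : 0 < 1 - γ := by linarith
  have hS0 := polMat_nonneg_aux P π hP hπ
  have hS1 := polMat_sum_aux P π hP hπ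
  have hT0 := polMat_nonneg_aux Pstar π hPstar hπ
  have hT1 := polMat_sum_aux Pstar π hPstar hπ
  have huS := isUnit_det_aux γ hγ0 hγ1 _ hS0 hS1
  have huT := isUnit_det_aux γ hγ0 hγ1 _ hT0 hT1
  have hN := inv_nonneg_aux γ hγ0 hγ1 _ hT0 hT1
  set V := valueFn γ P r π with hV
  set N := ((1 : Matrix X X ℝ) - γ • polMat Pstar π)⁻¹ with hNdef
  have hVeq : ((1 : Matrix X X ℝ) - γ • polMat P π) *ᵥ V = polRew r π := by
    rw [hV, valueFn, Matrix.mulVec_mulVec, Matrix.mul_nonsing_inv _ huS, Matrix.one_mulVec]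
  have hVb : ∀ x, |V x| ≤ Rmax / (1 - γ) := by
    apply value_bound_aux γ hγ0 hγ1 _ hS0 hS1
    intro x
    rw [hVeq]
    calc |polRew r π x| ≤ ∑ a, |π x a * r x a| := Finset.abs_sum_le_sum_abs _ _
      _ ≤ ∑ a, π x a * Rmax := Finset.sum_le_sum fun a _ => by
          rw [abs_mul, abs_of_nonneg (hπ.1 x a)]
          exact mul_le_mul_of_nonneg_left (hr x a) (hπ.1 x a)
      _ = Rmax := by rw [← Finset.sum_mul, hπ.2, one_mul]
  set w : X → ℝ := (polMat P π - polMat Pstar π) *ᵥ V with hw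
  have hdiff : V - valueFn γ Pstar r π = N *ᵥ (γ • w) := by
    have h1 : V = N *ᵥ (((1 : Matrix X X ℝ) - γ • polMat Pstar π) *ᵥ V) := by
      rw [Matrix.mulVec_mulVec, hNdef, Matrix.nonsing_inv_mul _ huT, Matrix.one_mulVec]
    have h2 : ((1 : Matrix X X ℝ) - γ • polMat Pstar π) *ᵥ V = polRew r π + γ • w := by
      rw [← hVeq, hw, ← Matrix.smul_mulVec, ← Matrix.add_mulVec]
      congr 1
      rw [smul_sub]
      abel
    rw [h2, Matrix.mulVec_add] at h1
    have h3 : valueFn γ Pstar r π = N *ᵥ polRew r π := rfl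
    rw [h3, sub_eq_iff_eq_add']
    exact h1
  have hwb : ∀ x, |w x| ≤ 2 * polErr e π x * (Rmax / (1 - γ)) := by
    intro x
    have hC : 0 ≤ Rmax / (1 - γ) := div_nonneg hR hg.le
    calc |w x| ≤ ∑ y, |(polMat P π - polMat Pstar π) x y * V y| :=
          Finset.abs_sum_le_sum_abs _ _
      _ ≤ ∑ y, (∑ a, π x a * (|P x a y - Phat x a y| + |Pstar x a y - Phat x a y|))
            * (Rmax / (1 - γ)) := Finset.sum_le_sum fun y _ => by
          rw [abs_mul]
          refine mul_le_mul ?_ (hVb y) (abs_nonneg _) ?_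
          · simp only [Matrix.sub_apply, polMat, Matrix.of_apply]
            rw [← Finset.sum_sub_distrib]
            refine (Finset.abs_sum_le_sum_abs _ _).trans (Finset.sum_le_sum fun a _ => ?_)
            rw [← mul_sub, abs_mul, abs_of_nonneg (hπ.1 x a)]
            refine mul_le_mul_of_nonneg_left ?_ (hπ.1 x a)
            rw [abs_sub_comm (Pstar x a y)]
            exact abs_sub_le _ _ _
          · exact Finset.sum_nonneg fun a _ => mul_nonneg (hπ.1 x a) (by positivity)
      _ ≤ 2 * polErr e π x * (Rmax / (1 - γ)) := by
          rw [← Finset.sum_mul]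
          refine mul_le_mul_of_nonneg_right ?_ hC
          rw [Finset.sum_comm, polErr, Finset.mul_sum]
          refine Finset.sum_le_sum fun a _ => ?_
          rw [← Finset.mul_sum, Finset.sum_add_distrib]
          have := mul_le_mul_of_nonneg_left (add_le_add (hPU x a) (hAsm x a)) (hπ.1 x a)
          linarith
  have hret : ret p0 γ P r π - ret p0 γ Pstar r π = ∑ y, p0 y * (N *ᵥ (γ • w)) y := by
    rw [← hdiff, ret, ret, ← Finset.sum_sub_distrib]
    refine Finset.sum_congr rfl fun y _ => ?_
    rw [Pi.sub_apply]
    ring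
  rw [hret]
  calc |∑ y, p0 y * (N *ᵥ (γ • w)) y|
      ≤ ∑ y, |p0 y * (N *ᵥ (γ • w)) y| := Finset.abs_sum_le_sum_abs _ _
    _ ≤ ∑ y, p0 y * ∑ x, N y x * (γ * (2 * polErr e π x * (Rmax / (1 - γ)))) :=
        Finset.sum_le_sum fun y _ => by
          rw [abs_mul, abs_of_nonneg (hp0 y)]
          refine mul_le_mul_of_nonneg_left ?_ (hp0 y)
          refine (Finset.abs_sum_le_sum_abs _ _).trans (Finset.sum_le_sum fun x _ => ?_)
          rw [abs_mul, abs_of_nonneg (hN y x), Pi.smul_apply, smul_eq_mul, abs_mul,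
            abs_of_nonneg hγ0]
          exact mul_le_mul_of_nonneg_left
            (mul_le_mul_of_nonneg_left (hwb x) hγ0) (hN y x)
    _ = 2 * γ * Rmax / (1 - γ) ^ 2 * ∑ x, occupancy p0 γ Pstar π x * polErr e π x := by
        simp only [occupancy, ← hNdef, Finset.mul_sum, Finset.sum_mul]
        rw [Finset.sum_comm]
        refine Finset.sum_congr rfl fun x _ => Finset.sum_congr rfl fun y _ => ?_
        field_simp
end
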